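/- Let d = 1 or d = 2, and let K and L be d-dimensional convex bodies with K ⊆ L. Then det A(K) ≤ det A(L), i.e., the determinant of the covariance matrix of a uniformly random point is monotone under inclusion in dimensions 1 and 2. -/

import Mathlib

open MeasureTheory

/-- A convex body in `ℝ^d`: a compact convex set with nonempty interior. -/
def IsConvexBody {d : ℕ} (K : Set (EuclideanSpace ℝ (Fin d))) : Prop :=
  IsCompact K ∧ Convex ℝ K ∧ (interior K).Nonempty

/-- The centroid `μ(K)` of `K`: the expectation of a uniformly random point of `K`. -/
noncomputable def centroid {d : ℕ} (K : Set (EuclideanSpace ℝ (Fin d))) :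
    EuclideanSpace ℝ (Fin d) :=
  ⨍ x in K, x

/-- The covariance matrix `A(K)` of a uniformly random point of `K`. -/
noncomputable def covMatrix {d : ℕ} (K : Set (EuclideanSpace ℝ (Fin d))) :
    Matrix (Fin d) (Fin d) ℝ :=
  Matrix.of fun i j => ⨍ x in K, (x i - centroid K i) * (x j - centroid K j)

/-- A nonnegative density on `[0, b]` that is concave on its support satisfies
`2 (∫ w) (∫ z² w) ≤ 3 (∫ z w)²`. -/
theorem two_mul_integral_sq_le_of_concave (w : ℝ → ℝ) (b : ℝ) (hw0 : ∀ z, 0 ≤ w z)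
    (hneg : ∀ z, z < 0 → w z = 0) (hb : ∀ z, b < z → w z = 0)
    (hconc : ∀ x y, 0 < w x → 0 < w y → ∀ p q : ℝ, 0 ≤ p → 0 ≤ q → p + q = 1 →
      p * w x + q * w y ≤ w (p * x + q * y))
    (h0 : Integrable w) (h1 : Integrable fun z => z * w z)
    (h2 : Integrable fun z => z ^ 2 * w z) :
    2 * (∫ z, w z) * (∫ z, z ^ 2 * w z) ≤ 3 * (∫ z, z * w z) ^ 2 := by
  set m := ∫ z, w z with hm
  set v := ∫ z, z * w z with hv
  set s := ∫ z, z ^ 2 * w z with hs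
  have hzw : ∀ z, 0 ≤ z * w z := by
    intro z
    rcases lt_or_ge z 0 with h | h
    · simp [hneg z h]
    · exact mul_nonneg h (hw0 z)
  have hm0 : 0 ≤ m := integral_nonneg hw0
  have hv0 : 0 ≤ v := integral_nonneg hzw
  have hsb : s ≤ b * v := by
    rw [hv, ← integral_const_mul]
    refine integral_mono h2 (h1.const_mul b) fun z => ?_
    rcases lt_or_ge b z with h | h
    · simp [hb z h]
    · have := mul_le_mul_of_nonneg_right h (hzw z)
      simp only
      nlinarith
  rcases hm0.eq_or_lt with hm' | hm'
  · rw [← hm']; nlinarith [sq_nonneg v]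
  rcases hv0.eq_or_lt with hv' | hv'
  · rw [← hv'] at hsb ⊢
    nlinarith
  set β := 3 * v / m with hβ
  set c := 2 * m ^ 3 / (9 * v ^ 2) with hc
  have hβ0 : 0 < β := by positivity
  have hc0 : 0 < c := by positivity
  set l : ℝ → ℝ := (Set.Icc 0 β).indicator fun z => c * (β - z) with hl
  have key : ∀ F : ℝ → ℝ, Continuous F → Integrable (fun z => F z * l z) ∧
      ∫ z, F z * l z = ∫ z in (0 : ℝ)..β, F z * (c * (β - z)) := by
    intro F hF
    have : (fun z => F z * l z) = (Set.Icc 0 β).indicator fun z => F z * (c * (β - z)) := by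
      ext z
      by_cases h : z ∈ Set.Icc 0 β <;> simp [hl, h]
    rw [this, integral_indicator measurableSet_Icc, intervalIntegral.integral_of_le hβ0.le,
      ← integral_Icc_eq_integral_Ioc, integrable_indicator_iff measurableSet_Icc]
    refine ⟨?_, rfl⟩
    exact (by fun_prop : Continuous fun z => F z * (c * (β - z))).integrableOn_Icc
  obtain ⟨i0, e0⟩ := key (fun _ => 1) (by fun_prop)
  obtain ⟨i1, e1⟩ := key (fun z => z) (by fun_prop)
  obtain ⟨i2, e2⟩ := key (fun z => z ^ 2) (by fun_prop)
  simp only [one_mul] at i0 e0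
  have e0' : ∫ z, l z = m := by
    rw [e0]
    have : ∀ z ∈ Set.uIcc 0 β, HasDerivAt (fun z => c * (β * z - z ^ 2 / 2)) (c * (β - z)) z := by
      intro z _
      have := (((hasDerivAt_id z).const_mul β).sub ((hasDerivAt_pow 2 z).div_const 2)).const_mul c
      exact HasDerivAt.congr_deriv this (by simp; try ring)
    rw [intervalIntegral.integral_eq_sub_of_hasDerivAt this
      (by apply Continuous.intervalIntegrable; fun_prop)]
    rw [hc, hβ]; field_simp; ring
  have e1' : ∫ z, z * l z = v := by
    rw [e1]
    have : ∀ z ∈ Set.uIcc 0 β, HasDerivAt (fun z => c * (β * (z ^ 2 / 2) - z ^ 3 / 3))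
        (z * (c * (β - z))) z := by
      intro z _
      have := ((((hasDerivAt_pow 2 z).div_const 2).const_mul β).sub
        ((hasDerivAt_pow 3 z).div_const 3)).const_mul c
      exact HasDerivAt.congr_deriv this (by simp; try ring)
    rw [intervalIntegral.integral_eq_sub_of_hasDerivAt this
      (by apply Continuous.intervalIntegrable; fun_prop)]
    rw [hc, hβ]; field_simp; ring
  have e2' : ∫ z, z ^ 2 * l z = 3 * v ^ 2 / (2 * m) := by
    rw [e2]
    have : ∀ z ∈ Set.uIcc 0 β, HasDerivAt (fun z => c * (β * (z ^ 3 / 3) - z ^ 4 / 4))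
        (z ^ 2 * (c * (β - z))) z := by
      intro z _
      have := ((((hasDerivAt_pow 3 z).div_const 3).const_mul β).sub
        ((hasDerivAt_pow 4 z).div_const 4)).const_mul c
      exact HasDerivAt.congr_deriv this (by simp; try ring)
    rw [intervalIntegral.integral_eq_sub_of_hasDerivAt this
      (by apply Continuous.intervalIntegrable; fun_prop)]
    rw [hc, hβ]; field_simp; ring
  set P : Set ℝ := {z | 0 ≤ z ∧ 0 < w z ∧ c * (β - z) < w z} with hP
  have hPconv : P.OrdConnected := by
    have : Convex ℝ P := by
      rintro x ⟨hx0, hx1, hx2⟩ y ⟨hy0, hy1, hy2⟩ p q hp hq hpq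
      have h := hconc x y hx1 hy1 p q hp hq hpq
      simp only [smul_eq_mul]
      have hpq' : 0 < p ∨ 0 < q := by
        by_contra! hh
        linarith [hh.1, hh.2]
      refine ⟨by positivity, lt_of_lt_of_le ?_ h, lt_of_lt_of_le ?_ h⟩
      · rcases hpq' with hh | hh <;> positivity
      · have e : c * (β - (p * x + q * y)) = p * (c * (β - x)) + q * (c * (β - y)) := by
          have : β = p * β + q * β := by rw [← add_mul, hpq, one_mul]
          linear_combination c * this
        rw [e]
        rcases hpq' with hh | hh
        · have := mul_lt_mul_of_pos_left hx2 hh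
          have := mul_le_mul_of_nonneg_left hy2.le hq
          linarith
        · have := mul_lt_mul_of_pos_left hy2 hh
          have := mul_le_mul_of_nonneg_left hx2.le hp
          linarith
    exact this.ordConnected
  have hPbelow : BddBelow P := ⟨0, fun z hz => hz.1⟩
  have hPabove : BddAbove P := ⟨b, fun z hz => by
    by_contra! h
    exact hz.2.1.ne' (hb z h)⟩
  have hpt : ∀ z, (z - sInf P) * (z - sSup P) * (w z - l z) ≤ 0 := by
    intro z
    rcases lt_or_ge z 0 with hz | hz
    · have : l z = 0 := by simp [hl, hz.not_ge]
      simp [hneg z hz, this]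
    · have hlz : l z = max (c * (β - z)) 0 := by
        by_cases h : z ≤ β
        · rw [max_eq_left (mul_nonneg hc0.le (by linarith))]
          simp [hl, hz, h]
        · rw [max_eq_right (mul_nonpos_of_nonneg_of_nonpos hc0.le (by linarith))]
          simp [hl, h]
      by_cases hzP : z ∈ P
      · have hA : 0 ≤ z - sInf P := sub_nonneg.2 (csInf_le hPbelow hzP)
        have hB : z - sSup P ≤ 0 := sub_nonpos.2 (le_csSup hPabove hzP)
        have hC : 0 ≤ w z - l z := by
          rw [hlz]; exact sub_nonneg.2 (max_le hzP.2.2.le hzP.2.1.le)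
        exact mul_nonpos_of_nonpos_of_nonneg (mul_nonpos_of_nonneg_of_nonpos hA hB) hC
      · have hC : w z - l z ≤ 0 := by
          rw [hlz, sub_nonpos]
          by_contra! h
          exact hzP ⟨hz, (max_lt_iff.1 h).2, (max_lt_iff.1 h).1⟩
        refine mul_nonpos_of_nonneg_of_nonpos ?_ hC
        rcases P.eq_empty_or_nonempty with hE | hE
        · simp [hE]; positivity
        · by_contra! hlt
          have hle : sInf P ≤ sSup P := by
            obtain ⟨x, hx⟩ := hE
            exact (csInf_le hPbelow hx).trans (le_csSup hPabove hx)
          have h1 : sInf P < z := by nlinarith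
          have h2 : z < sSup P := by nlinarith
          obtain ⟨x, hx, hxz⟩ := exists_lt_of_csInf_lt hE h1
          obtain ⟨y, hy, hyz⟩ := exists_lt_of_lt_csSup hE h2
          exact hzP (hPconv.out hx hy ⟨hxz.le, hyz.le⟩)
  have hint : ∫ z, (z - sInf P) * (z - sSup P) * (w z - l z) ≤ 0 := integral_nonpos hpt
  have hexp : ∫ z, (z - sInf P) * (z - sSup P) * (w z - l z) = s - 3 * v ^ 2 / (2 * m) := by
    have : (fun z => (z - sInf P) * (z - sSup P) * (w z - l z)) = fun z =>
        (z ^ 2 * w z - z ^ 2 * l z) - (sInf P + sSup P) * (z * w z - z * l z)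
          + sInf P * sSup P * (w z - l z) := by
      ext z; ring
    have j0 := (h0.sub i0).const_mul (sInf P * sSup P)
    have j1 := (h1.sub i1).const_mul (sInf P + sSup P)
    have j2 : Integrable fun z => z ^ 2 * w z - z ^ 2 * l z := h2.sub i2
    simp only [Pi.sub_apply] at j0 j1
    rw [this, integral_add (by exact j2.sub j1) j0,
      integral_sub j2 j1, integral_const_mul, integral_const_mul,
      integral_sub h2 i2, integral_sub h1 i1, integral_sub h0 i0, e0', e1', e2', ← hm, ← hv, ← hs]
    ring
  rw [hexp, sub_nonpos, le_div_iff₀ (by positivity)] at hint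
  linarith

/-- The lengths of the vertical chords of a planar convex body form a concave function. -/
theorem volume_real_chord_concave {S : Set (ℝ × ℝ)} (hS : IsCompact S) (hc : Convex ℝ S)
    {x y : ℝ} (hx : 0 < volume.real (Prod.mk x ⁻¹' S)) (hy : 0 < volume.real (Prod.mk y ⁻¹' S))
    {p q : ℝ} (hp : 0 ≤ p) (hq : 0 ≤ q) (hpq : p + q = 1) :
    p * volume.real (Prod.mk x ⁻¹' S) + q * volume.real (Prod.mk y ⁻¹' S) ≤
      volume.real (Prod.mk (p * x + q * y) ⁻¹' S) := by
  have hcomp : ∀ z : ℝ, IsCompact (Prod.mk z ⁻¹' S) := by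
    intro z
    have : Prod.mk z ⁻¹' S = Prod.snd '' (S ∩ {r | r.1 = z}) := by
      ext t
      constructor
      · intro ht; exact ⟨(z, t), ⟨ht, rfl⟩, rfl⟩
      · rintro ⟨⟨a, b⟩, ⟨h1, h2⟩, rfl⟩
        obtain rfl : a = z := h2
        exact h1
    rw [this]
    exact (hS.inter_right (isClosed_eq continuous_fst continuous_const)).image continuous_snd
  have hconv : ∀ z : ℝ, Convex ℝ (Prod.mk z ⁻¹' S) := by
    intro z s hs t ht a b ha hb hab
    have := hc hs ht ha hb hab
    simp only [Prod.smul_mk, Prod.mk_add_mk, ← add_smul, hab, one_smul] at this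
    exact this
  have hne : ∀ z : ℝ, 0 < volume.real (Prod.mk z ⁻¹' S) → (Prod.mk z ⁻¹' S).Nonempty := by
    intro z hz
    by_contra! h
    simp [h] at hz
  have hIcc : ∀ z : ℝ, 0 < volume.real (Prod.mk z ⁻¹' S) →
      ∃ a b, a ≤ b ∧ Prod.mk z ⁻¹' S = Set.Icc a b := by
    intro z hz
    have h := eq_Icc_of_connected_compact ⟨hne z hz, (hconv z).isPreconnected⟩ (hcomp z)
    refine ⟨_, _, ?_, h⟩
    have := hne z hz
    rw [h] at this
    exact Set.nonempty_Icc.1 this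
  obtain ⟨a, b, hab, h1⟩ := hIcc x hx
  obtain ⟨c, d, hcd, h2⟩ := hIcc y hy
  have ha : (x, a) ∈ S := by
    have : a ∈ Prod.mk x ⁻¹' S := by rw [h1]; exact Set.left_mem_Icc.2 hab
    exact this
  have hb : (x, b) ∈ S := by
    have : b ∈ Prod.mk x ⁻¹' S := by rw [h1]; exact Set.right_mem_Icc.2 hab
    exact this
  have hc' : (y, c) ∈ S := by
    have : c ∈ Prod.mk y ⁻¹' S := by rw [h2]; exact Set.left_mem_Icc.2 hcd
    exact this
  have hd : (y, d) ∈ S := by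
    have : d ∈ Prod.mk y ⁻¹' S := by rw [h2]; exact Set.right_mem_Icc.2 hcd
    exact this
  have hsub : Set.Icc (p * a + q * c) (p * b + q * d) ⊆ Prod.mk (p * x + q * y) ⁻¹' S :=
    (hconv _).ordConnected.out (hc ha hc' hp hq hpq) (hc hb hd hp hq hpq)
  rw [h1, h2, Real.volume_real_Icc_of_le hab, Real.volume_real_Icc_of_le hcd]
  have := measureReal_mono (μ := volume) hsub (hcomp _).measure_lt_top.ne
  rw [Real.volume_real_Icc_of_le (by gcongr)] at this
  linarith

theorem setIntegral_fst_eq {S : Set (ℝ × ℝ)} (hS : IsCompact S) {F : ℝ → ℝ} (hF : Continuous F) :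
    Integrable (fun z => F z * volume.real (Prod.mk z ⁻¹' S)) ∧
      ∫ r in S, F r.1 = ∫ z, F z * volume.real (Prod.mk z ⁻¹' S) := by
  have hi : Integrable (S.indicator fun r : ℝ × ℝ => F r.1) :=
    (integrable_indicator_iff hS.measurableSet).2
      ((hF.comp continuous_fst).continuousOn.integrableOn_compact hS)
  have hin : ∀ z : ℝ, ∫ t, S.indicator (fun r : ℝ × ℝ => F r.1) (z, t) =
      F z * volume.real (Prod.mk z ⁻¹' S) := by
    intro z
    have : (fun t => S.indicator (fun r : ℝ × ℝ => F r.1) (z, t)) =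
        (Prod.mk z ⁻¹' S).indicator fun _ => F z := by
      ext t
      by_cases h : (z, t) ∈ S <;> simp [h]
    rw [this, integral_indicator_const _ (measurable_prodMk_left hS.measurableSet), smul_eq_mul,
      mul_comm]
  constructor
  · have := Integrable.integral_prod_left (μ := (volume : Measure ℝ)) (ν := (volume : Measure ℝ)) hi
    simpa only [hin] using this
  · rw [← integral_indicator hS.measurableSet, Measure.volume_eq_prod, integral_prod _ hi]
    simp only [hin]

theorem two_mul_setIntegral_sq_le_prod {S : Set (ℝ × ℝ)} (hS : IsCompact S) (hc : Convex ℝ S)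
    (h : ℝ) (hpos : ∀ r ∈ S, 0 ≤ r.1 + h) :
    2 * volume.real S * (∫ r in S, (r.1 + h) ^ 2) ≤ 3 * (∫ r in S, (r.1 + h)) ^ 2 := by
  set W : ℝ → ℝ := fun z => volume.real (Prod.mk z ⁻¹' S) with hW
  obtain ⟨i0, e0⟩ := setIntegral_fst_eq hS (F := fun _ => 1) (by fun_prop)
  obtain ⟨i1, e1⟩ := setIntegral_fst_eq hS (F := fun z => z + h) (by fun_prop)
  obtain ⟨i2, e2⟩ := setIntegral_fst_eq hS (F := fun z => (z + h) ^ 2) (by fun_prop)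
  simp only [one_mul] at i0 e0
  have e0' : volume.real S = ∫ z, W z := by
    rw [← e0]; simp
  have hemp : ∀ z, (∀ t, (z, t) ∉ S) → W z = 0 := by
    intro z hz
    have : Prod.mk z ⁻¹' S = ∅ := by ext t; simp [hz t]
    simp [hW, this]
  obtain ⟨b, hb⟩ := (hS.image continuous_fst).bddAbove
  have s0 := integral_sub_right_eq_self (μ := volume) W h
  have s1 := integral_sub_right_eq_self (μ := volume) (fun z => (z + h) * W z) h
  have s2 := integral_sub_right_eq_self (μ := volume) (fun z => (z + h) ^ 2 * W z) h
  have j0 := i0.comp_sub_right h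
  have j1 := i1.comp_sub_right h
  have j2 := i2.comp_sub_right h
  simp only [sub_add_cancel] at s1 s2 j1 j2
  rw [e0', e1, e2, ← s0, ← s1, ← s2]
  refine two_mul_integral_sq_le_of_concave (fun z => W (z - h)) (b + h)
    (fun z => measureReal_nonneg) ?_ ?_ ?_ j0 j1 j2
  · intro z hz
    refine hemp _ fun t ht => ?_
    have := hpos _ ht
    simp only [sub_add_cancel] at this
    linarith
  · intro z hz
    refine hemp _ fun t ht => ?_
    have := hb ⟨_, ht, rfl⟩
    simp only at this
    linarith
  · intro x y hx hy p q hp hq hpq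
    have e : p * x + q * y - h = p * (x - h) + q * (y - h) := by linear_combination h * hpq
    simp only [e]
    exact volume_real_chord_concave hS hc hx hy hp hq hpq

theorem two_mul_setIntegral_sq_le_unit {L : Set (EuclideanSpace ℝ (Fin 2))} (hL : IsCompact L)
    (hc : Convex ℝ L) (e : EuclideanSpace ℝ (Fin 2)) (he : ‖e‖ = 1) (h : ℝ)
    (hpos : ∀ x ∈ L, 0 ≤ inner ℝ e x + h) :
    2 * volume.real L * (∫ x in L, (inner ℝ e x + h) ^ 2) ≤
      3 * (∫ x in L, (inner ℝ e x + h)) ^ 2 := by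
  obtain ⟨b, hb⟩ := Orthonormal.exists_orthonormalBasis_extension_of_card_eq (𝕜 := ℝ)
    (E := EuclideanSpace ℝ (Fin 2)) (ι := Fin 2) (by simp) (v := fun _ => e) (s := {0})
    ⟨fun _ => he, fun i j hij => (hij (Subsingleton.elim i j)).elim⟩
  have hb0 : b 0 = e := hb 0 rfl
  let φ : EuclideanSpace ℝ (Fin 2) ≃ᵐ ℝ × ℝ :=
    (b.repr.toHomeomorph.toMeasurableEquiv.trans (MeasurableEquiv.toLp 2 (Fin 2 → ℝ)).symm).trans
      MeasurableEquiv.finTwoArrow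
  have hφ : ∀ x, φ x = (inner ℝ e x, inner ℝ (b 1) x) := by
    intro x
    have h0 : b.repr x 0 = inner ℝ e x := by rw [b.repr_apply_apply, hb0]
    have h1 : b.repr x 1 = inner ℝ (b 1) x := b.repr_apply_apply x 1
    rw [← h0, ← h1]
    rfl
  have hmp : MeasurePreserving φ volume volume :=
    (b.measurePreserving_repr.trans
      (EuclideanSpace.volume_preserving_symm_measurableEquiv_toLp (Fin 2))).trans
        (volume_preserving_finTwoArrow ℝ)
  have hφ' : ⇑φ = fun x => (inner ℝ e x, inner ℝ (b 1) x) := funext hφ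
  have hint : ∀ G : ℝ → ℝ, ∫ x in L, G (inner ℝ e x) = ∫ r in φ '' L, G r.1 := by
    intro G
    rw [hmp.setIntegral_image_emb φ.measurableEmbedding]
    simp only [hφ]
  have hcomp : IsCompact (φ '' L) := by
    rw [hφ']
    exact hL.image (by fun_prop)
  have hconv : Convex ℝ (φ '' L) := by
    rintro _ ⟨x, hx, rfl⟩ _ ⟨y, hy, rfl⟩ p q hp hq hpq
    refine ⟨_, hc hx hy hp hq hpq, ?_⟩
    simp [hφ, inner_add_right, inner_smul_right]
  have hvol : volume.real L = volume.real (φ '' L) := by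
    have := hint fun _ => 1
    simpa using this
  have := two_mul_setIntegral_sq_le_prod hcomp hconv h (by
    rintro _ ⟨x, hx, rfl⟩
    simpa [hφ] using hpos x hx)
  rw [hvol, hint fun t => (t + h) ^ 2, hint fun t => t + h]
  exact this

/-- For a planar convex body `L` in the half-plane `⟪u, x⟫ ≤ H`, the distance to the boundary
of the half-plane has second moment at most `3 / 2` times its squared first moment. -/
theorem two_mul_setIntegral_sq_le {L : Set (EuclideanSpace ℝ (Fin 2))} (hL : IsCompact L)
    (hc : Convex ℝ L) (u : EuclideanSpace ℝ (Fin 2)) (H : ℝ) (hH : ∀ x ∈ L, inner ℝ u x ≤ H) :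
    2 * volume.real L * (∫ x in L, (H - inner ℝ u x) ^ 2) ≤
      3 * (∫ x in L, (H - inner ℝ u x)) ^ 2 := by
  by_cases hu : u = 0
  · subst hu
    simp only [inner_zero_left, sub_zero, setIntegral_const, smul_eq_mul]
    nlinarith [sq_nonneg (volume.real L * H)]
  have hn : 0 < ‖u‖ := norm_pos_iff.2 hu
  have key : ∀ x, H - inner ℝ u x = ‖u‖ * (inner ℝ (-(‖u‖⁻¹ • u)) x + H / ‖u‖) := by
    intro x
    rw [inner_neg_left, inner_smul_left]
    simp only [map_inv₀, conj_trivial]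
    field_simp
    ring
  have := two_mul_setIntegral_sq_le_unit hL hc (-(‖u‖⁻¹ • u))
    (by rw [norm_neg, norm_smul, norm_inv, norm_norm, inv_mul_cancel₀ hn.ne']) (H / ‖u‖) (by
      intro x hx
      have h := hH x hx
      have h' := key x
      by_contra! hlt
      have := mul_neg_of_pos_of_neg hn hlt
      linarith)
  simp only [key, mul_pow, integral_const_mul]
  nlinarith [mul_le_mul_of_nonneg_left this (sq_nonneg ‖u‖)]

theorem setIntegral_coord {d : ℕ} {K : Set (EuclideanSpace ℝ (Fin d))} (hK : IsCompact K)
    (hV : 0 < volume.real K) (i : Fin d) :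
    ∫ x in K, x i = volume.real K * centroid K i := by
  have hi : Integrable (fun x : EuclideanSpace ℝ (Fin d) => x) (volume.restrict K) :=
    continuous_id.continuousOn.integrableOn_compact hK
  have h := (EuclideanSpace.proj (𝕜 := ℝ) i).integral_comp_comm hi
  simp only [PiLp.proj_apply] at h
  rw [h, centroid, setAverage_eq, PiLp.smul_apply, smul_eq_mul, mul_inv_cancel_left₀ hV.ne']

/-- Second moments about an arbitrary point in terms of the covariance matrix. -/
theorem setIntegral_coord_mul_coord {d : ℕ} {K : Set (EuclideanSpace ℝ (Fin d))}
    (hK : IsCompact K) (hV : 0 < volume.real K) (p : EuclideanSpace ℝ (Fin d)) (i j : Fin d) :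
    ∫ x in K, (x i - p i) * (x j - p j) =
      volume.real K * (covMatrix K i j + (centroid K i - p i) * (centroid K j - p j)) := by
  have hI : ∀ f : EuclideanSpace ℝ (Fin d) → ℝ, Continuous f → IntegrableOn f K :=
    fun f hf => hf.continuousOn.integrableOn_compact hK
  have hcov : ∫ x in K, (x i - centroid K i) * (x j - centroid K j) =
      volume.real K * covMatrix K i j := by
    rw [covMatrix, Matrix.of_apply, setAverage_eq, smul_eq_mul, mul_inv_cancel_left₀ hV.ne']
  have hz : ∀ k, ∫ x in K, (x k - centroid K k) = 0 := by
    intro k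
    rw [integral_sub (hI _ (by fun_prop)) (hI _ (by fun_prop)), setIntegral_coord hK hV,
      setIntegral_const, smul_eq_mul, sub_self]
  have e : ∀ x : EuclideanSpace ℝ (Fin d), (x i - p i) * (x j - p j) =
      (x i - centroid K i) * (x j - centroid K j) + (centroid K i - p i) * (x j - centroid K j) +
        (centroid K j - p j) * (x i - centroid K i) +
        (centroid K i - p i) * (centroid K j - p j) := by
    intro x; ring
  refine (integral_congr_ae (Filter.Eventually.of_forall e)).trans ?_
  rw [integral_add (hI _ (by fun_prop)) (hI _ (by fun_prop)),
    integral_add (hI _ (by fun_prop)) (hI _ (by fun_prop)),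
    integral_add (hI _ (by fun_prop)) (hI _ (by fun_prop)), integral_const_mul,
    integral_const_mul, hz, hz, hcov, setIntegral_const, smul_eq_mul]
  ring

theorem covMatrix_symm {d : ℕ} (K : Set (EuclideanSpace ℝ (Fin d))) (i j : Fin d) :
    covMatrix K i j = covMatrix K j i := by
  simp only [covMatrix, Matrix.of_apply]
  congr 1
  ext x
  ring

theorem setIntegral_quadratic {K : Set (EuclideanSpace ℝ (Fin 2))}
    (hK : IsCompact K) (hV : 0 < volume.real K) (p : EuclideanSpace ℝ (Fin 2)) (a b c : ℝ) :
    ∫ x in K, (a * (x 0 - p 0) ^ 2 + 2 * b * ((x 0 - p 0) * (x 1 - p 1)) + c * (x 1 - p 1) ^ 2) =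
      volume.real K * (a * (covMatrix K 0 0 + (centroid K 0 - p 0) ^ 2) +
        2 * b * (covMatrix K 0 1 + (centroid K 0 - p 0) * (centroid K 1 - p 1)) +
        c * (covMatrix K 1 1 + (centroid K 1 - p 1) ^ 2)) := by
  have hI : ∀ f : EuclideanSpace ℝ (Fin 2) → ℝ, Continuous f → IntegrableOn f K :=
    fun f hf => hf.continuousOn.integrableOn_compact hK
  rw [integral_add (hI _ (by fun_prop)) (hI _ (by fun_prop)),
    integral_add (hI _ (by fun_prop)) (hI _ (by fun_prop)), integral_const_mul,
    integral_const_mul, integral_const_mul]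
  simp only [pow_two]
  rw [setIntegral_coord_mul_coord hK hV, setIntegral_coord_mul_coord hK hV,
    setIntegral_coord_mul_coord hK hV]
  ring

/-- The variance of the functional `x ↦ u₀ x₀ + u₁ x₁` of a uniformly random point of `K`. -/
noncomputable def covForm (K : Set (EuclideanSpace ℝ (Fin 2))) (u₀ u₁ : ℝ) : ℝ :=
  covMatrix K 0 0 * u₀ ^ 2 + 2 * covMatrix K 0 1 * (u₀ * u₁) + covMatrix K 1 1 * u₁ ^ 2

theorem setIntegral_linear_sq {K : Set (EuclideanSpace ℝ (Fin 2))}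
    (hK : IsCompact K) (hV : 0 < volume.real K) (p : EuclideanSpace ℝ (Fin 2)) (u₀ u₁ : ℝ) :
    ∫ x in K, (u₀ * (x 0 - p 0) + u₁ * (x 1 - p 1)) ^ 2 =
      volume.real K * (covForm K u₀ u₁ +
        (u₀ * (centroid K 0 - p 0) + u₁ * (centroid K 1 - p 1)) ^ 2) := by
  have e : ∀ x : EuclideanSpace ℝ (Fin 2), (u₀ * (x 0 - p 0) + u₁ * (x 1 - p 1)) ^ 2 =
      u₀ ^ 2 * (x 0 - p 0) ^ 2 + 2 * (u₀ * u₁) * ((x 0 - p 0) * (x 1 - p 1)) +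
        u₁ ^ 2 * (x 1 - p 1) ^ 2 := by
    intro x; ring
  simp only [e]
  rw [setIntegral_quadratic hK hV, covForm]
  ring

theorem covForm_nonneg {K : Set (EuclideanSpace ℝ (Fin 2))}
    (hK : IsCompact K) (hV : 0 < volume.real K) (u₀ u₁ : ℝ) : 0 ≤ covForm K u₀ u₁ := by
  have h := setIntegral_linear_sq hK hV (centroid K) u₀ u₁
  have h' : 0 ≤ ∫ x in K, (u₀ * (x 0 - centroid K 0) + u₁ * (x 1 - centroid K 1)) ^ 2 :=
    integral_nonneg fun x => sq_nonneg _
  rw [h] at h'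
  simp only [sub_self, mul_zero, add_zero] at h'
  nlinarith [(mul_nonneg_iff_of_pos_left hV).1 (by simpa using h')]

theorem volume_mul_covForm_mono {K L : Set (EuclideanSpace ℝ (Fin 2))}
    (hK : IsCompact K) (hL : IsCompact L) (hV : 0 < volume.real K) (hKL : K ⊆ L) (u₀ u₁ : ℝ) :
    volume.real K * covForm K u₀ u₁ ≤ volume.real L * covForm L u₀ u₁ := by
  have hVL : 0 < volume.real L := hV.trans_le (measureReal_mono hKL hL.measure_lt_top.ne)
  have h1 := setIntegral_linear_sq hK hV (centroid L) u₀ u₁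
  have h2 := setIntegral_linear_sq hL hVL (centroid L) u₀ u₁
  have h3 : ∫ x in K, (u₀ * (x 0 - centroid L 0) + u₁ * (x 1 - centroid L 1)) ^ 2 ≤
      ∫ x in L, (u₀ * (x 0 - centroid L 0) + u₁ * (x 1 - centroid L 1)) ^ 2 :=
    setIntegral_mono_set ((by fun_prop : Continuous fun x : EuclideanSpace ℝ (Fin 2) =>
      (u₀ * (x 0 - centroid L 0) + u₁ * (x 1 - centroid L 1)) ^ 2).continuousOn.integrableOn_compact
        hL) (Filter.Eventually.of_forall fun x => sq_nonneg _) hKL.eventuallyLE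
  rw [h1, h2] at h3
  simp only [sub_self, mul_zero, add_zero] at h3
  nlinarith [mul_nonneg hV.le
    (sq_nonneg (u₀ * (centroid K 0 - centroid L 0) + u₁ * (centroid K 1 - centroid L 1)))]

theorem inner_eq_coord (u x : EuclideanSpace ℝ (Fin 2)) :
    inner ℝ u x = u 0 * x 0 + u 1 * x 1 := by
  simp [PiLp.inner_apply, Fin.sum_univ_two, mul_comm]

/-- The gap between the support function of a planar convex body and its centroid is at least
`√2` standard deviations. -/
theorem two_mul_covForm_le {L : Set (EuclideanSpace ℝ (Fin 2))} (hL : IsCompact L)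
    (hc : Convex ℝ L) (hV : 0 < volume.real L) (u : EuclideanSpace ℝ (Fin 2)) (H : ℝ)
    (hH : ∀ x ∈ L, inner ℝ u x ≤ H) :
    inner ℝ u (centroid L) ≤ H ∧
      2 * covForm L (u 0) (u 1) ≤ (H - inner ℝ u (centroid L)) ^ 2 := by
  have hI : ∀ f : EuclideanSpace ℝ (Fin 2) → ℝ, Continuous f → IntegrableOn f L :=
    fun f hf => hf.continuousOn.integrableOn_compact hL
  have hv : ∫ x in L, (H - inner ℝ u x) = volume.real L * (H - inner ℝ u (centroid L)) := by
    simp only [inner_eq_coord]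
    rw [integral_sub (hI _ (by fun_prop)) (hI _ (by fun_prop)),
      integral_add (hI _ (by fun_prop)) (hI _ (by fun_prop)), integral_const_mul,
      integral_const_mul, setIntegral_coord hL hV, setIntegral_coord hL hV, setIntegral_const,
      smul_eq_mul]
    ring
  have hs : ∫ x in L, (H - inner ℝ u x) ^ 2 =
      volume.real L * (covForm L (u 0) (u 1) + (H - inner ℝ u (centroid L)) ^ 2) := by
    have e : ∀ x, (H - inner ℝ u x) ^ 2 =
        (u 0 * (x 0 - centroid L 0) + u 1 * (x 1 - centroid L 1)) ^ 2 +
          (2 * (H - inner ℝ u (centroid L)) * (H - inner ℝ u x) -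
            (H - inner ℝ u (centroid L)) ^ 2) := by
      intro x
      simp only [inner_eq_coord]
      ring
    refine (integral_congr_ae (Filter.Eventually.of_forall e)).trans ?_
    rw [integral_add (hI _ (by fun_prop)) (hI _ (by fun_prop)),
      integral_sub (hI _ (by fun_prop)) (hI _ (by fun_prop)), integral_const_mul, hv,
      setIntegral_linear_sq hL hV, setIntegral_const, smul_eq_mul]
    ring
  have h0 : 0 ≤ ∫ x in L, (H - inner ℝ u x) :=
    setIntegral_nonneg hL.measurableSet fun x hx => sub_nonneg.2 (hH x hx)
  have h := two_mul_setIntegral_sq_le hL hc u H hH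
  rw [hv] at h0
  refine ⟨by linarith [(mul_nonneg_iff_of_pos_left hV).1 h0], ?_⟩
  rw [hv, hs] at h
  have hV2 : 0 < volume.real L ^ 2 := by positivity
  refine le_of_mul_le_mul_left ?_ hV2
  nlinarith

theorem det_covMatrix_two (K : Set (EuclideanSpace ℝ (Fin 2))) :
    (covMatrix K).det = covMatrix K 0 0 * covMatrix K 1 1 - covMatrix K 0 1 ^ 2 := by
  rw [Matrix.det_fin_two, covMatrix_symm K 1 0]
  ring

theorem det_covMatrix_nonneg {K : Set (EuclideanSpace ℝ (Fin 2))}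
    (hK : IsCompact K) (hV : 0 < volume.real K) : 0 ≤ (covMatrix K).det := by
  have h := discrim_le_zero (a := covMatrix K 0 0) (b := 2 * covMatrix K 0 1)
    (c := covMatrix K 1 1) fun x => by
      have := covForm_nonneg hK hV x 1
      rw [covForm] at this
      nlinarith
  rw [discrim] at h
  rw [det_covMatrix_two]
  nlinarith

/-- The quadratic form of the adjugate of the covariance matrix. -/
noncomputable def adjugateForm (K : Set (EuclideanSpace ℝ (Fin 2))) (y₀ y₁ : ℝ) : ℝ :=
  covForm K (-y₁) y₀

theorem det_mul_sq_le_adjugateForm_mul (K : Set (EuclideanSpace ℝ (Fin 2))) (y₀ y₁ u₀ u₁ : ℝ) :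
    (covMatrix K).det * (u₀ * y₀ + u₁ * y₁) ^ 2 ≤ adjugateForm K y₀ y₁ * covForm K u₀ u₁ := by
  rw [det_covMatrix_two, adjugateForm, covForm, covForm]
  linarith [sq_nonneg (covMatrix K 0 0 * (-y₁) * u₀ +
    covMatrix K 0 1 * (-y₁ * u₁ + y₀ * u₀) + covMatrix K 1 1 * y₀ * u₁)]

/-- Points of `L` outside a convex body `K ⊆ L` near `L` have almost critical Mahalanobis
distance from the centroid of `L`. -/
theorem det_mul_le_adjugateForm {K L : Set (EuclideanSpace ℝ (Fin 2))} (hK : IsCompact K)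
    (hKc : Convex ℝ K) (hL : IsCompact L) (hLc : Convex ℝ L) (hVL : 0 < volume.real L)
    {ε r : ℝ} (hε : 0 ≤ ε) (hnear : ∀ x ∈ L, ∃ k ∈ K, ‖x - k‖ ≤ ε) (hr : 0 < r)
    (hLr : ∀ u₀ u₁, r ^ 2 * (u₀ ^ 2 + u₁ ^ 2) ≤ covForm L u₀ u₁)
    {x : EuclideanSpace ℝ (Fin 2)} (hx : x ∈ L \ K) :
    (covMatrix L).det * (2 - 3 * (ε / r)) ≤
      adjugateForm L (x 0 - centroid L 0) (x 1 - centroid L 1) := by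
  obtain ⟨hxL, hxK⟩ := hx
  set e := ε / r with he
  have he0 : 0 ≤ e := by positivity
  have hεr : ε = e * r := by rw [he]; field_simp
  obtain ⟨f, t, hft, htx⟩ := geometric_hahn_banach_closed_point hKc hK.isClosed hxK
  obtain ⟨u, hu⟩ : ∃ u : EuclideanSpace ℝ (Fin 2), ∀ y, f y = inner ℝ u y :=
    ⟨(InnerProductSpace.toDual ℝ _).symm f, fun y => by simp⟩
  have hH : ∀ y ∈ L, inner ℝ u y ≤ inner ℝ u x + ε * ‖u‖ := by
    intro y hy
    obtain ⟨k, hk, hyk⟩ := hnear y hy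
    have h1 : inner ℝ u k < inner ℝ u x := by
      rw [← hu, ← hu]; exact (hft k hk).trans htx
    have h2 : inner ℝ u y = inner ℝ u k + inner ℝ u (y - k) := by
      rw [← inner_add_right]; congr 1; abel
    have h3 := real_inner_le_norm u (y - k)
    have h4 : ‖u‖ * ‖y - k‖ ≤ ‖u‖ * ε := mul_le_mul_of_nonneg_left hyk (norm_nonneg _)
    linarith
  obtain ⟨hG0, hG⟩ := two_mul_covForm_le hL hLc hVL u _ hH
  obtain ⟨k, hk, -⟩ := hnear x hxL
  have hu0 : u ≠ 0 := by
    rintro rfl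
    have h1 := (hft k hk).trans htx
    rw [hu, hu] at h1
    simp at h1
  have hnorm : ‖u‖ ^ 2 = u 0 ^ 2 + u 1 ^ 2 := by
    rw [← real_inner_self_eq_norm_sq, inner_eq_coord]; ring
  have hq := hLr (u 0) (u 1)
  rw [← hnorm] at hq
  set q := covForm L (u 0) (u 1) with hqdef
  set y := inner ℝ u x - inner ℝ u (centroid L) with hy
  have hq0 : 0 < q := lt_of_lt_of_le (by positivity) hq
  set σ := Real.sqrt q with hσ
  have hσ0 : 0 < σ := Real.sqrt_pos.2 hq0
  have hσ2 : σ ^ 2 = q := Real.sq_sqrt hq0.le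
  have hrσ : r * ‖u‖ ≤ σ := Real.le_sqrt_of_sq_le (by rw [mul_pow]; exact hq)
  have hεσ : ε * ‖u‖ ≤ e * σ := by
    rw [hεr, mul_assoc]; exact mul_le_mul_of_nonneg_left hrσ he0
  have hs2 : Real.sqrt 2 ^ 2 = 2 := Real.sq_sqrt (by norm_num)
  have hs0 : 0 < Real.sqrt 2 := by positivity
  have hs3 : Real.sqrt 2 ≤ 3 / 2 := by nlinarith
  have hG' : Real.sqrt 2 * σ ≤ y + ε * ‖u‖ := by
    refine abs_le_of_sq_le_sq' ?_ (by linarith) |>.2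
    rw [mul_pow, hs2, hσ2]
    calc 2 * q ≤ _ := hG
      _ = _ := by rw [hy]; ring
  have hyσ : (Real.sqrt 2 - e) * σ ≤ y := by linarith
  have hy2 : (2 - 3 * e) * q ≤ y ^ 2 := by
    rw [← hσ2]
    rcases le_or_gt e (Real.sqrt 2) with h | h
    · have h1 : 0 ≤ (Real.sqrt 2 - e) * σ := mul_nonneg (by linarith) hσ0.le
      have h2 : ((Real.sqrt 2 - e) * σ) ^ 2 ≤ y ^ 2 := pow_le_pow_left₀ h1 hyσ 2
      have h3 : 2 - 3 * e ≤ (Real.sqrt 2 - e) ^ 2 := by nlinarith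
      have h4 := mul_le_mul_of_nonneg_right h3 (sq_nonneg σ)
      rw [mul_pow] at h2
      linarith
    · have : 2 - 3 * e ≤ 0 := by nlinarith
      nlinarith [mul_nonneg_of_nonpos_of_nonpos this (neg_nonpos.2 (sq_nonneg σ)), sq_nonneg y]
  have hyx : y = u 0 * (x 0 - centroid L 0) + u 1 * (x 1 - centroid L 1) := by
    rw [hy, inner_eq_coord, inner_eq_coord]; ring
  have hLag := det_mul_sq_le_adjugateForm_mul L (x 0 - centroid L 0) (x 1 - centroid L 1)
    (u 0) (u 1)
  rw [← hyx] at hLag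
  refine le_of_mul_le_mul_right ?_ hq0
  calc (covMatrix L).det * (2 - 3 * e) * q = (covMatrix L).det * ((2 - 3 * e) * q) := by ring
    _ ≤ (covMatrix L).det * y ^ 2 :=
      mul_le_mul_of_nonneg_left hy2 (det_covMatrix_nonneg hL hVL)
    _ ≤ _ := hLag

/-- One small step: if `K ⊆ L` and `L` is within distance `ε` of `K`, then the determinant of the
covariance matrix of `K` exceeds that of `L` at most by a second-order factor. -/
theorem det_covMatrix_le_of_near {K L : Set (EuclideanSpace ℝ (Fin 2))} (hK : IsCompact K)
    (hKc : Convex ℝ K) (hL : IsCompact L) (hLc : Convex ℝ L) (hV : 0 < volume.real K)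
    (hKL : K ⊆ L) {ε r : ℝ} (hε : 0 ≤ ε) (hnear : ∀ x ∈ L, ∃ k ∈ K, ‖x - k‖ ≤ ε) (hr : 0 < r)
    (hLr : ∀ u₀ u₁, r ^ 2 * (u₀ ^ 2 + u₁ ^ 2) ≤ covForm L u₀ u₁) :
    (covMatrix K).det ≤ (covMatrix L).det *
      (1 + 3 / 2 * (ε / r) * ((volume.real L - volume.real K) / volume.real K)) ^ 2 := by
  have hVKL : volume.real K ≤ volume.real L := measureReal_mono hKL hL.measure_lt_top.ne
  have hVL : 0 < volume.real L := hV.trans_le hVKL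
  rw [det_covMatrix_two, det_covMatrix_two]
  set a := covMatrix L 0 0 with ha
  set b := covMatrix L 0 1 with hb
  set c := covMatrix L 1 1 with hc
  set a' := covMatrix K 0 0 with ha'
  set b' := covMatrix K 0 1 with hb'
  set c' := covMatrix K 1 1 with hc'
  set μ := centroid L with hμ
  have hform : ∀ u₀ u₁, covForm L u₀ u₁ = a * u₀ ^ 2 + 2 * b * (u₀ * u₁) + c * u₁ ^ 2 :=
    fun _ _ => rfl
  have ha0 : 0 < a := by
    have := hLr 1 0
    rw [hform] at this
    nlinarith [pow_pos hr 2]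
  have hD : 0 < a * c - b ^ 2 := by
    have h := hLr (-b) a
    rw [hform] at h
    have : 0 < r ^ 2 * ((-b) ^ 2 + a ^ 2) := by positivity
    refine pos_of_mul_pos_right (a := a) ?_ ha0.le
    nlinarith
  set D := a * c - b ^ 2 with hDdef
  set e := ε / r with he
  set Q : EuclideanSpace ℝ (Fin 2) → ℝ := fun x =>
    c * (x 0 - μ 0) ^ 2 + 2 * (-b) * ((x 0 - μ 0) * (x 1 - μ 1)) + a * (x 1 - μ 1) ^ 2 with hQ
  have hQc : Continuous Q := by fun_prop
  have hQpt : ∀ x ∈ L \ K, D * (2 - 3 * e) ≤ Q x := by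
    intro x hx
    have h := det_mul_le_adjugateForm hK hKc hL hLc hVL hε hnear hr hLr hx
    rw [det_covMatrix_two] at h
    simp only [hQ, hDdef, he]
    refine h.trans_eq ?_
    rw [adjugateForm, covForm]
    ring
  have hQL : ∫ x in L, Q x = volume.real L * (2 * D) := by
    rw [hQ, setIntegral_quadratic hL hVL, ← ha, ← hb, ← hc, hDdef]
    simp only [← hμ, sub_self]
    ring
  have hQI : IntegrableOn Q L := hQc.continuousOn.integrableOn_compact hL
  have hsplit : ∫ x in L \ K, Q x = (∫ x in L, Q x) - ∫ x in K, Q x :=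
    setIntegral_sdiff hK.measurableSet hQI hKL
  have hdiff : (volume.real L - volume.real K) * (D * (2 - 3 * e)) ≤ ∫ x in L \ K, Q x := by
    have h := setIntegral_mono_on (f := fun _ => D * (2 - 3 * e)) (g := Q) (s := L \ K)
      (μ := volume) (integrableOn_const (ne_top_of_le_ne_top hL.measure_lt_top.ne
        (measure_mono Set.sdiff_subset))) (hQI.mono_set Set.sdiff_subset)
      (hL.measurableSet.diff hK.measurableSet) hQpt
    rw [setIntegral_const, measureReal_sdiff hKL hK.measurableSet hL.measure_lt_top.ne, smul_eq_mul] at h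
    exact h
  have hQK : volume.real K * (c * a' + 2 * (-b) * b' + a * c') ≤ ∫ x in K, Q x := by
    rw [hQ, setIntegral_quadratic hK hV, ← ha', ← hb', ← hc']
    refine mul_le_mul_of_nonneg_left ?_ hV.le
    have := covForm_nonneg hL hVL (-(centroid K 1 - μ 1)) (centroid K 0 - μ 0)
    rw [hform] at this
    nlinarith
  set T := c * a' + 2 * (-b) * b' + a * c' with hT
  set η := (volume.real L - volume.real K) / volume.real K with hη
  have hVη : volume.real L = volume.real K * (1 + η) := by
    rw [hη]; field_simp; ring
  have hTle : T ≤ 2 * (D * (1 + 3 / 2 * e * η)) := by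
    refine le_of_mul_le_mul_left ?_ hV
    rw [hsplit, hQL] at hdiff
    rw [hVη] at hdiff
    nlinarith
  have hdisc : 4 * D * (a' * c' - b' ^ 2) ≤ T ^ 2 := by
    have h : a ^ 2 * (T ^ 2 - 4 * D * (a' * c' - b' ^ 2)) =
        (2 * D * a' - T * a) ^ 2 + 4 * D * (b' * a - a' * b) ^ 2 := by
      rw [hT, hDdef]; ring
    have h2 : 0 ≤ a ^ 2 * (T ^ 2 - 4 * D * (a' * c' - b' ^ 2)) := by
      rw [h]; positivity
    have := (mul_nonneg_iff_of_pos_left (pow_pos ha0 2)).1 h2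
    linarith
  have hT0 : 0 ≤ T := by
    have h1 := covForm_nonneg hK hV (-b) a
    have h2 := covForm_nonneg hK hV 1 0
    have hK1 : ∀ u₀ u₁, covForm K u₀ u₁ = a' * u₀ ^ 2 + 2 * b' * (u₀ * u₁) + c' * u₁ ^ 2 :=
      fun _ _ => rfl
    rw [hK1] at h1 h2
    have h3 : a * T = a' * (-b) ^ 2 + 2 * b' * (-b * a) + c' * a ^ 2 + D * a' := by
      rw [hT, hDdef]; ring
    have h4 : 0 ≤ D * a' := mul_nonneg hD.le (by nlinarith)
    exact (mul_nonneg_iff_of_pos_left ha0).1 (by rw [h3]; linarith)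
  have hTsq : T ^ 2 ≤ (2 * (D * (1 + 3 / 2 * e * η))) ^ 2 := pow_le_pow_left₀ hT0 hTle 2
  refine le_of_mul_le_mul_left ?_ (by positivity : 0 < 4 * D)
  calc 4 * D * (a' * c' - b' ^ 2) ≤ _ := hdisc.trans hTsq
    _ = _ := by ring

/-- The Minkowski interpolation `(1 - t) K + t L`. -/
def minkowskiInterp {d : ℕ} (K L : Set (EuclideanSpace ℝ (Fin d))) (t : ℝ) :
    Set (EuclideanSpace ℝ (Fin d)) :=
  (fun p : EuclideanSpace ℝ (Fin d) × EuclideanSpace ℝ (Fin d) =>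
    (1 - t) • p.1 + t • p.2) '' (K ×ˢ L)

section minkowskiInterp

variable {d : ℕ} {K L : Set (EuclideanSpace ℝ (Fin d))}

theorem isCompact_minkowskiInterp (hK : IsCompact K) (hL : IsCompact L) (t : ℝ) :
    IsCompact (minkowskiInterp K L t) :=
  (hK.prod hL).image (by fun_prop)

theorem convex_minkowskiInterp (hK : Convex ℝ K) (hL : Convex ℝ L) (t : ℝ) :
    Convex ℝ (minkowskiInterp K L t) := by
  rintro _ ⟨⟨k, l⟩, ⟨hk, hl⟩, rfl⟩ _ ⟨⟨k', l'⟩, ⟨hk', hl'⟩, rfl⟩ a b ha hb hab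
  refine ⟨(a • k + b • k', a • l + b • l'), ⟨hK hk hk' ha hb hab, hL hl hl' ha hb hab⟩, ?_⟩
  simp only
  module

theorem minkowskiInterp_zero (hL : L.Nonempty) : minkowskiInterp K L 0 = K := by
  ext x
  constructor
  · rintro ⟨⟨k, l⟩, ⟨hk, -⟩, rfl⟩
    simpa using hk
  · intro hx
    obtain ⟨l, hl⟩ := hL
    exact ⟨(x, l), ⟨hx, hl⟩, by simp⟩

theorem minkowskiInterp_one (hK : K.Nonempty) : minkowskiInterp K L 1 = L := by
  ext x
  constructor
  · rintro ⟨⟨k, l⟩, ⟨-, hl⟩, rfl⟩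
    simpa using hl
  · intro hx
    obtain ⟨k, hk⟩ := hK
    exact ⟨(k, x), ⟨hk, hx⟩, by simp⟩

theorem minkowskiInterp_mono (hL : Convex ℝ L) (hKL : K ⊆ L) {s t : ℝ} (hs : 0 ≤ s)
    (hst : s ≤ t) : minkowskiInterp K L s ⊆ minkowskiInterp K L t := by
  rintro _ ⟨⟨k, l⟩, ⟨hk, hl⟩, rfl⟩
  rcases (hs.trans hst).eq_or_lt with ht | ht
  · obtain rfl : s = t := by linarith
    exact ⟨(k, l), ⟨hk, hl⟩, rfl⟩
  refine ⟨(k, ((t - s) / t) • k + (s / t) • l), ⟨hk, hL (hKL hk) hl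
    (div_nonneg (by linarith) ht.le) (div_nonneg hs ht.le) (by field_simp; ring)⟩, ?_⟩
  simp only [smul_add, smul_smul, mul_div_cancel₀ _ ht.ne']
  module

theorem exists_mem_minkowskiInterp_near {R : ℝ} (hR : ∀ k ∈ K, ∀ l ∈ L, ‖l - k‖ ≤ R) {s t : ℝ}
    (hst : s ≤ t) {x : EuclideanSpace ℝ (Fin d)} (hx : x ∈ minkowskiInterp K L t) :
    ∃ k ∈ minkowskiInterp K L s, ‖x - k‖ ≤ (t - s) * R := by
  obtain ⟨⟨k, l⟩, ⟨hk, hl⟩, rfl⟩ := hx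
  refine ⟨_, ⟨(k, l), ⟨hk, hl⟩, rfl⟩, ?_⟩
  have : (1 - t) • k + t • l - ((1 - s) • k + s • l) = (t - s) • (l - k) := by module
  simp only [this, norm_smul, Real.norm_eq_abs, abs_of_nonneg (sub_nonneg.2 hst)]
  exact mul_le_mul_of_nonneg_left (hR k hk l hl) (sub_nonneg.2 hst)

end minkowskiInterp

theorem IsConvexBody.volume_real_pos {d : ℕ} {K : Set (EuclideanSpace ℝ (Fin d))}
    (hK : IsConvexBody K) : 0 < volume.real K :=
  ENNReal.toReal_pos (isOpen_interior.measure_pos volume hK.2.2 |>.trans_le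
    (measure_mono interior_subset)).ne' hK.1.measure_lt_top.ne

/-- A function whose increments are bounded below up to a multiplicative error of second order
is monotone. -/
theorem le_of_le_mul_exp {D V : ℝ → ℝ} {κ : ℝ}
    (h : ∀ s t, 0 ≤ s → s ≤ t → t ≤ 1 → D s ≤ D t * Real.exp (κ * (t - s) * (V t - V s))) :
    D 0 ≤ D 1 := by
  have key : ∀ N : ℕ, D 0 * Real.exp (κ * V 0 * (1 / ((N : ℝ) + 1))) ≤
      D 1 * Real.exp (κ * V 1 * (1 / ((N : ℝ) + 1))) := by
    intro N
    set δ : ℝ := 1 / ((N : ℝ) + 1) with hδ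
    have hδ1 : ((N + 1 : ℕ) : ℝ) * δ = 1 := by rw [hδ]; push_cast; field_simp
    have hstep : ∀ i : ℕ, i ≤ N + 1 → D 0 * Real.exp (κ * V 0 * δ) ≤
        D (i * δ) * Real.exp (κ * V (i * δ) * δ) := by
      intro i
      induction i with
      | zero => intro _; simp
      | succ i ih =>
        intro hi
        refine (ih (by omega)).trans ?_
        have hi' : ((i + 1 : ℕ) : ℝ) * δ ≤ 1 := by
          rw [← hδ1]; gcongr
        have h1 := h (i * δ) ((i + 1 : ℕ) * δ) (by positivity)
          (by push_cast; nlinarith) hi'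
        have e1 : ((i + 1 : ℕ) : ℝ) * δ - i * δ = δ := by push_cast; ring
        rw [e1] at h1
        refine (mul_le_mul_of_nonneg_right h1 (Real.exp_pos _).le).trans_eq ?_
        rw [mul_assoc, ← Real.exp_add]
        congr 2
        ring
    have := hstep (N + 1) le_rfl
    rwa [hδ1] at this
  have hlim : ∀ c d : ℝ, Filter.Tendsto (fun N : ℕ => c * Real.exp (d * (1 / ((N : ℝ) + 1))))
      Filter.atTop (nhds c) := by
    intro c d
    have h0 := tendsto_one_div_add_atTop_nhds_zero_nat (𝕜 := ℝ)
    have h1 : Continuous fun x : ℝ => c * Real.exp (d * x) := by fun_prop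
    have := (h1.tendsto 0).comp h0
    simpa [Function.comp_def] using this
  exact le_of_tendsto_of_tendsto' (hlim _ _) (hlim _ _) key

theorem det_covMatrix_mono_two {K L : Set (EuclideanSpace ℝ (Fin 2))}
    (hK : IsConvexBody K) (hL : IsConvexBody L) (hKL : K ⊆ L) :
    (covMatrix K).det ≤ (covMatrix L).det := by
  have hVK := hK.volume_real_pos
  have hVL := hL.volume_real_pos
  obtain ⟨hKk, hKc, hKi⟩ := hK
  obtain ⟨hLk, hLc, hLi⟩ := hL
  have hKne : K.Nonempty := hKi.mono interior_subset
  have hLne : L.Nonempty := hLi.mono interior_subset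
  rcases (det_covMatrix_nonneg hKk hVK).eq_or_lt with hD | hD
  · rw [← hD]; exact det_covMatrix_nonneg hLk hVL
  set M := minkowskiInterp K L with hM
  have hM0 : M 0 = K := minkowskiInterp_zero hLne
  have hM1 : M 1 = L := minkowskiInterp_one hKne
  have hKM : ∀ t, 0 ≤ t → K ⊆ M t := fun t ht =>
    hM0.symm.subset.trans (minkowskiInterp_mono hLc hKL le_rfl ht)
  have hML : ∀ t, 0 ≤ t → t ≤ 1 → M t ⊆ L := fun t ht ht' =>
    (minkowskiInterp_mono hLc hKL ht ht').trans hM1.subset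
  have hMk : ∀ t, IsCompact (M t) := isCompact_minkowskiInterp hKk hLk
  have hMc : ∀ t, Convex ℝ (M t) := convex_minkowskiInterp hKc hLc
  have hVM : ∀ t, 0 ≤ t → volume.real K ≤ volume.real (M t) := fun t ht =>
    measureReal_mono (hKM t ht) (hMk t).measure_lt_top.ne
  have hVM' : ∀ t, 0 ≤ t → t ≤ 1 → volume.real (M t) ≤ volume.real L := fun t ht ht' =>
    measureReal_mono (hML t ht ht') hLk.measure_lt_top.ne
  obtain ⟨R, hR0, hR⟩ : ∃ R : ℝ, 0 ≤ R ∧ ∀ k ∈ K, ∀ l ∈ L, ‖l - k‖ ≤ R := by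
    obtain ⟨R, hR⟩ := hLk.isBounded.exists_norm_le
    refine ⟨R + R, ?_, fun k hk l hl => (norm_sub_le _ _).trans
      (add_le_add (hR l hl) (hR k (hKL hk)))⟩
    obtain ⟨l, hl⟩ := hLne
    linarith [(norm_nonneg l).trans (hR l hl)]
  have htr : 0 < covMatrix K 0 0 + covMatrix K 1 1 := by
    have h0 := covForm_nonneg hKk hVK 1 0
    have h1 := covForm_nonneg hKk hVK 0 1
    rw [covForm] at h0 h1
    rw [det_covMatrix_two] at hD
    by_contra! h
    have h2 : covMatrix K 0 0 = 0 := by linarith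
    rw [h2] at hD
    nlinarith [sq_nonneg (covMatrix K 0 1)]
  set ρ := volume.real K * (covMatrix K).det /
    ((covMatrix K 0 0 + covMatrix K 1 1) * volume.real L) with hρ
  have hρ0 : 0 < ρ := by positivity
  have hρK : ∀ u₀ u₁, ρ * volume.real L * (u₀ ^ 2 + u₁ ^ 2) ≤
      volume.real K * covForm K u₀ u₁ := by
    intro u₀ u₁
    have e : (covMatrix K 0 0 + covMatrix K 1 1) * covForm K u₀ u₁ =
        (covMatrix K).det * (u₀ ^ 2 + u₁ ^ 2) +
          ((covMatrix K 0 0 * u₀ + covMatrix K 0 1 * u₁) ^ 2 +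
            (covMatrix K 0 1 * u₀ + covMatrix K 1 1 * u₁) ^ 2) := by
      rw [det_covMatrix_two, covForm]; ring
    have e2 : ρ * volume.real L * (covMatrix K 0 0 + covMatrix K 1 1) =
        volume.real K * (covMatrix K).det := by
      rw [hρ]; field_simp
    refine le_of_mul_le_mul_left ?_ htr
    calc (covMatrix K 0 0 + covMatrix K 1 1) * (ρ * volume.real L * (u₀ ^ 2 + u₁ ^ 2))
        = volume.real K * ((covMatrix K).det * (u₀ ^ 2 + u₁ ^ 2)) := by
          linear_combination (u₀ ^ 2 + u₁ ^ 2) * e2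
      _ ≤ volume.real K * ((covMatrix K 0 0 + covMatrix K 1 1) * covForm K u₀ u₁) := by
          refine mul_le_mul_of_nonneg_left ?_ hVK.le
          rw [e]
          exact le_add_of_nonneg_right (by positivity)
      _ = _ := by ring
  set r := Real.sqrt ρ with hr
  have hr0 : 0 < r := Real.sqrt_pos.2 hρ0
  have hr2 : r ^ 2 = ρ := Real.sq_sqrt hρ0.le
  have hMr : ∀ t, 0 ≤ t → t ≤ 1 → ∀ u₀ u₁, r ^ 2 * (u₀ ^ 2 + u₁ ^ 2) ≤ covForm (M t) u₀ u₁ := by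
    intro t ht ht' u₀ u₁
    have h1 := volume_mul_covForm_mono hKk (hMk t) hVK (hKM t ht) u₀ u₁
    have h2 := covForm_nonneg (hMk t) (hVK.trans_le (hVM t ht)) u₀ u₁
    have h3 := mul_le_mul_of_nonneg_right (hVM' t ht ht') h2
    rw [hr2]
    refine le_of_mul_le_mul_left ?_ hVL
    linarith [hρK u₀ u₁]
  have hmain := le_of_le_mul_exp (D := fun t => (covMatrix (M t)).det)
    (V := fun t => volume.real (M t)) (κ := 3 * (R / r) / volume.real K) (by
      intro s t hs hst ht
      have ht0 := hs.trans hst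
      have hst' : M s ⊆ M t := minkowskiInterp_mono hLc hKL hs hst
      have hVs := hVK.trans_le (hVM s hs)
      have hVst : volume.real (M s) ≤ volume.real (M t) :=
        measureReal_mono hst' (hMk t).measure_lt_top.ne
      have h := det_covMatrix_le_of_near (hMk s) (hMc s) (hMk t) (hMc t) hVs hst'
        (mul_nonneg (sub_nonneg.2 hst) hR0)
        (fun x hx => exists_mem_minkowskiInterp_near hR hst hx) hr0 (hMr t ht0 ht)
      refine h.trans (mul_le_mul_of_nonneg_left ?_
        (det_covMatrix_nonneg (hMk t) (hVK.trans_le (hVM t ht0))))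
      set η := 3 / 2 * (R / r) / volume.real K * (t - s) *
        (volume.real (M t) - volume.real (M s)) with hη
      have hle : 3 / 2 * ((t - s) * R / r) *
          ((volume.real (M t) - volume.real (M s)) / volume.real (M s)) ≤ η := by
        have e : η = 3 / 2 * ((t - s) * R / r) *
            ((volume.real (M t) - volume.real (M s)) / volume.real K) := by
          rw [hη]; ring
        rw [e]
        refine mul_le_mul_of_nonneg_left ?_ ?_
        · exact div_le_div_of_nonneg_left (sub_nonneg.2 hVst) hVK (hVM s hs)
        · have := sub_nonneg.2 hst
          positivity
      have h0 : 0 ≤ 3 / 2 * ((t - s) * R / r) *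
          ((volume.real (M t) - volume.real (M s)) / volume.real (M s)) := by
        have := sub_nonneg.2 hst
        have := sub_nonneg.2 hVst
        positivity
      calc (1 + 3 / 2 * ((t - s) * R / r) *
          ((volume.real (M t) - volume.real (M s)) / volume.real (M s))) ^ 2
          ≤ Real.exp η ^ 2 := by
            refine pow_le_pow_left₀ (by linarith) ?_ 2
            linarith [Real.add_one_le_exp η]
        _ = _ := by
            rw [← Real.exp_nat_mul]
            congr 1
            rw [hη]; push_cast; ring)
  simpa only [hM0, hM1] using hmain

theorem det_covMatrix_one {a b : ℝ} (hab : a < b) {K : Set (EuclideanSpace ℝ (Fin 1))}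
    (hK : IsCompact K) (hKab : ∀ x : EuclideanSpace ℝ (Fin 1), x ∈ K ↔ x 0 ∈ Set.Icc a b) :
    (covMatrix K).det = (b - a) ^ 2 / 12 := by
  let φ : EuclideanSpace ℝ (Fin 1) ≃ᵐ ℝ :=
    (MeasurableEquiv.toLp 2 (Fin 1 → ℝ)).symm.trans (MeasurableEquiv.funUnique (Fin 1) ℝ)
  have hφ : ∀ x, φ x = x 0 := fun x => rfl
  have hmp : MeasurePreserving φ volume volume :=
    (EuclideanSpace.volume_preserving_symm_measurableEquiv_toLp (Fin 1)).trans
      (volume_preserving_funUnique (Fin 1) ℝ)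
  have hKpre : K = φ ⁻¹' Set.Icc a b := by
    ext x
    rw [hKab]
    rfl
  have hint : ∀ G : ℝ → ℝ, ∫ x in K, G (x 0) = ∫ y in a..b, G y := by
    intro G
    rw [intervalIntegral.integral_of_le hab.le, ← integral_Icc_eq_integral_Ioc, hKpre,
      ← hmp.setIntegral_preimage_emb φ.measurableEmbedding]
    simp only [hφ]
  have hVol : volume.real K = b - a := by
    have := hint fun _ => 1
    simpa using this
  have hV : 0 < volume.real K := by rw [hVol]; linarith
  have h1 := setIntegral_coord hK hV 0
  have h2 := setIntegral_coord_mul_coord hK hV 0 0 0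
  have i1 := hint fun y => y
  have i2 := hint fun y => (y - 0) * (y - 0)
  simp only [PiLp.zero_apply, sub_zero] at h2 i2
  rw [i1, integral_id, hVol] at h1
  simp only [← pow_two] at h2 i2
  rw [i2, integral_pow, hVol] at h2
  have hba : b - a ≠ 0 := by linarith
  have hμ : centroid K 0 = (a + b) / 2 := by
    refine mul_left_cancel₀ hba ?_
    rw [← h1]; ring
  rw [Matrix.det_unique, Fin.default_eq_zero]
  refine mul_left_cancel₀ hba ?_
  rw [hμ] at h2
  norm_num at h2
  linear_combination -h2

theorem IsConvexBody.exists_coord_mem_Icc {K : Set (EuclideanSpace ℝ (Fin 1))}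
    (hK : IsConvexBody K) :
    ∃ a b : ℝ, a < b ∧ ∀ x : EuclideanSpace ℝ (Fin 1), x ∈ K ↔ x 0 ∈ Set.Icc a b := by
  have hV := hK.volume_real_pos
  obtain ⟨hKk, hKc, hKi⟩ := hK
  have hne : K.Nonempty := hKi.mono interior_subset
  have hcont : Continuous fun x : EuclideanSpace ℝ (Fin 1) => x 0 := by fun_prop
  have hconn : IsConnected K := ⟨hne, hKc.isPreconnected⟩
  have h := eq_Icc_of_connected_compact (hconn.image _ hcont.continuousOn) (hKk.image hcont)
  set a := sInf ((fun x : EuclideanSpace ℝ (Fin 1) => x 0) '' K)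
  set b := sSup ((fun x : EuclideanSpace ℝ (Fin 1) => x 0) '' K)
  have hmem : ∀ x : EuclideanSpace ℝ (Fin 1), x ∈ K ↔ x 0 ∈ Set.Icc a b := by
    intro x
    rw [← h]
    refine ⟨fun hx => ⟨x, hx, rfl⟩, ?_⟩
    rintro ⟨y, hy, hyx⟩
    have : y = x := by
      ext i
      rw [Subsingleton.elim i 0]
      exact hyx
    exact this ▸ hy
  refine ⟨a, b, ?_, hmem⟩
  by_contra! hba
  have hsub : K.Subsingleton := by
    intro x hx y hy
    have h1 := (hmem x).1 hx
    have h2 := (hmem y).1 hy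
    ext i
    rw [Subsingleton.elim i 0]
    linarith [h1.1, h1.2, h2.1, h2.2]
  have : volume.real K = 0 := by
    rw [measureReal_def, hsub.measure_zero volume, ENNReal.toReal_zero]
  linarith

theorem det_covMatrix_mono_one {K L : Set (EuclideanSpace ℝ (Fin 1))}
    (hK : IsConvexBody K) (hL : IsConvexBody L) (hKL : K ⊆ L) :
    (covMatrix K).det ≤ (covMatrix L).det := by
  obtain ⟨a, b, hab, h1⟩ := hK.exists_coord_mem_Icc
  obtain ⟨a', b', hab', h2⟩ := hL.exists_coord_mem_Icc
  rw [det_covMatrix_one hab hK.1 h1, det_covMatrix_one hab' hL.1 h2]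
  have hIcc : Set.Icc a b ⊆ Set.Icc a' b' := by
    intro y hy
    have : EuclideanSpace.single (0 : Fin 1) y ∈ K := (h1 _).2 (by simpa using hy)
    simpa using (h2 _).1 (hKL this)
  obtain ⟨ha, hb⟩ := (Set.Icc_subset_Icc_iff hab.le).1 hIcc
  have : (b - a) ^ 2 ≤ (b' - a') ^ 2 := pow_le_pow_left₀ (by linarith) (by linarith) 2
  linarith

/-- In dimensions 1 and 2 the determinant of the covariance matrix is monotone
under inclusion of convex bodies. -/
theorem det_covMatrix_monotone_low_dim
    (d : ℕ) (hd : d = 1 ∨ d = 2)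
    (K L : Set (EuclideanSpace ℝ (Fin d)))
    (hK : IsConvexBody K) (hL : IsConvexBody L) (hKL : K ⊆ L) :
    (covMatrix K).det ≤ (covMatrix L).det := by
  rcases hd with rfl | rfl
  · exact det_covMatrix_mono_one hK hL hKL
  · exact det_covMatrix_mono_two hK hL hKL
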